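/- If σ is an effective i-chain on Δ with σ·h = 0 for every h ∈ ker⁺L_i (i.e., σ is effective of degree zero), then σ = 0. -/

import Mathlib

open Finset Matrix

/-- A finite abstract simplicial complex on the vertex set `Fin n`: a collection of
finite subsets of `Fin n` (its faces) closed under taking subsets. -/
structure SComplex (n : ℕ) where
  faces : Finset (Finset (Fin n))
  down_closed : ∀ s ∈ faces, ∀ t ⊆ s, t ∈ faces

namespace SComplex

variable {n : ℕ} (Δ : SComplex n)

/-- The faces of cardinality `k`, i.e. the `(k-1)`-dimensional faces. -/
def Faces (k : ℕ) : Finset (Finset (Fin n)) :=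
  Δ.faces.filter fun f => f.card = k

/-- The group of `(k-1)`-dimensional chains: formal `ℤ`-linear combinations of the
faces of cardinality `k`.  (So `Chain 0` plays the role of `C_{-1}(Δ) ≅ ℤ`, generated
by the empty face, and `Chain (i+1)` is the group `C_i(Δ)` of `i`-dimensional chains.) -/
abbrev Chain (k : ℕ) : Type := {f // f ∈ Δ.Faces k} → ℤ

/-- The sign `(-1)^j` with which the subface `g` (obtained from `f` by deleting its
`j`-th smallest vertex) occurs in the boundary of `f`; `0` if `g` is not a
codimension-one subface of `f`. -/
def bcoef (f g : Finset (Fin n)) : ℤ :=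
  if g ⊆ f ∧ f.card = g.card + 1 then
    ∑ v ∈ f \ g, (-1 : ℤ) ^ (f.filter (fun x => x < v)).card
  else 0

/-- The matrix (in the standard bases, with the standard orientation) of the boundary
map from chains on faces of cardinality `k+1` to chains on faces of cardinality `k`. -/
def B (k : ℕ) : Matrix {f // f ∈ Δ.Faces k} {f // f ∈ Δ.Faces (k + 1)} ℤ :=
  fun g f => bcoef (f : Finset (Fin n)) (g : Finset (Fin n))

/-- The simplicial boundary map `∂_k : C_k(Δ) → C_{k-1}(Δ)` (standard orientation),
as a map `Chain (k+1) → Chain k`.  For `k = 0` this is the reduced boundary map into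
`C_{-1}(Δ) ≅ ℤ`. -/
noncomputable def bdry (k : ℕ) : Δ.Chain (k + 1) →ₗ[ℤ] Δ.Chain k :=
  (Δ.B k).mulVecLin

/-- The transpose `∂_kᵗ` of the boundary map. -/
noncomputable def tbdry (k : ℕ) : Δ.Chain k →ₗ[ℤ] Δ.Chain (k + 1) :=
  ((Δ.B k)ᵀ).mulVecLin

/-- The matrix of the `i`-th (up-down combinatorial) Laplacian. -/
def LapM (i : ℕ) : Matrix {f // f ∈ Δ.Faces (i + 1)} {f // f ∈ Δ.Faces (i + 1)} ℤ :=
  Δ.B (i + 1) * (Δ.B (i + 1))ᵀ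

/-- The `i`-th Laplacian `L_i = ∂_{i+1} ∘ ∂_{i+1}ᵗ` on `i`-dimensional chains. -/
noncomputable def Lap (i : ℕ) : Δ.Chain (i + 1) →ₗ[ℤ] Δ.Chain (i + 1) :=
  (Δ.LapM i).mulVecLin

/-- A chain is effective if all of its coefficients are nonnegative. -/
def Effective {k : ℕ} (σ : Δ.Chain k) : Prop := ∀ f, 0 ≤ σ f

/-- `σ·h = Σ_f σ(f)h(f)`. -/
def dot {k : ℕ} (σ h : Δ.Chain k) : ℤ := ∑ f, σ f * h f

/-- The `i`-th nonnegative kernel `ker⁺L_i`: effective `i`-chains in `ker L_i`. -/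
def kerPlus (i : ℕ) : Set (Δ.Chain (i + 1)) :=
  {τ | Δ.Lap i τ = 0 ∧ Δ.Effective τ}

/-- Two `i`-chains are linearly equivalent if their difference lies in `im L_i`. -/
def LinEquiv (i : ℕ) (σ σ' : Δ.Chain (i + 1)) : Prop :=
  σ' - σ ∈ LinearMap.range (Δ.Lap i)

/-- An `i`-chain is winnable if it is linearly equivalent to an effective `i`-chain. -/
def Winnable (i : ℕ) (σ : Δ.Chain (i + 1)) : Prop :=
  ∃ σ', Δ.Effective σ' ∧ Δ.LinEquiv i σ σ'

/-- The Hilbert basis of `ker⁺L_i`: its nonzero elements that are not the sum of two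
nonzero elements of `ker⁺L_i`. -/
def hilbBasis (i : ℕ) : Set (Δ.Chain (i + 1)) :=
  {τ | τ ∈ Δ.kerPlus i ∧ τ ≠ 0 ∧
    ¬ ∃ a ∈ Δ.kerPlus i, ∃ b ∈ Δ.kerPlus i, a ≠ 0 ∧ b ≠ 0 ∧ τ = a + b}

/-- The cycles among the chains on faces of cardinality `k`: the kernel of the
(reduced) boundary map `∂_{k-1}`.  For `k = 0` (the `(-1)`-chains, where the boundary
map is zero) every chain is a cycle. -/
noncomputable def cycles : (k : ℕ) → Submodule ℤ (Δ.Chain k)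
  | 0 => ⊤
  | (k + 1) => LinearMap.ker (Δ.bdry k)

/-- The image of the `i`-th Laplacian, viewed inside the `i`-cycles. -/
noncomputable def critSub (i : ℕ) : Submodule ℤ ↥(Δ.cycles (i + 1)) :=
  Submodule.comap (Δ.cycles (i + 1)).subtype (LinearMap.range (Δ.Lap i))

/-- The `i`-th critical group `crit_i(Δ) = ker ∂_i / im L_i`. -/
noncomputable abbrev Crit (i : ℕ) : Type :=
  ↥(Δ.cycles (i + 1)) ⧸ Δ.critSub i

/-- The image of the boundary map `∂_k`, viewed inside the cycles `cycles k`. -/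
noncomputable def bdrySub (k : ℕ) : Submodule ℤ ↥(Δ.cycles k) :=
  Submodule.comap (Δ.cycles k).subtype (LinearMap.range (Δ.bdry k))

/-- The reduced homology group `H̃_{k-1}(Δ) = ker ∂_{k-1} / im ∂_k` (so the `i`-th
reduced homology group of `Δ` is `RedHomologyAt (i+1)`). -/
noncomputable abbrev RedHomologyAt (k : ℕ) : Type :=
  ↥(Δ.cycles k) ⧸ Δ.bdrySub k

/-- The orthogonal complement `(ker L_i)^⊥` of `ker L_i` in the `i`-chains. -/
def kerPerp (i : ℕ) : Submodule ℤ (Δ.Chain (i + 1)) where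
  carrier := {σ | ∀ τ ∈ LinearMap.ker (Δ.Lap i), Δ.dot σ τ = 0}
  add_mem' := by
    intro a b ha hb τ hτ
    have h : Δ.dot (a + b) τ = Δ.dot a τ + Δ.dot b τ := by
      simp [dot, Pi.add_apply, add_mul, Finset.sum_add_distrib]
    rw [h, ha τ hτ, hb τ hτ, add_zero]
  zero_mem' := by
    intro τ hτ
    simp [dot]
  smul_mem' := by
    intro c a ha τ hτ
    have h : Δ.dot (c • a) τ = c * Δ.dot a τ := by
      simp [dot, Pi.smul_apply, Finset.mul_sum, mul_assoc]
    rw [h, ha τ hτ, mul_zero]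

/-! ### Pseudomanifolds -/

/-- `Δ` is a pseudomanifold of dimension `d` (the facets are the faces of
cardinality `d+1`): it is pure, non-branching, and strongly connected. -/
def IsPseudomanifold (d : ℕ) : Prop :=
  (∀ f ∈ Δ.faces, ∃ g ∈ Δ.Faces (d + 1), f ⊆ g) ∧
  (∀ g ∈ Δ.Faces d, ((Δ.Faces (d + 1)).filter fun f => g ⊆ f).card ≤ 2) ∧
  (∀ f ∈ Δ.Faces (d + 1), ∀ f' ∈ Δ.Faces (d + 1),
    Relation.ReflTransGen
      (fun a b => a ∈ Δ.Faces (d + 1) ∧ b ∈ Δ.Faces (d + 1) ∧ (a ∩ b).card = d) f f')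

/-- The boundary `∂Δ` of a `d`-dimensional pseudomanifold: the `(d-1)`-faces contained
in exactly one facet. -/
def pmBoundary (d : ℕ) : Finset (Finset (Fin n)) :=
  (Δ.Faces d).filter fun g => ((Δ.Faces (d + 1)).filter fun f => g ⊆ f).card = 1

/-- A pseudomanifold orientation for a `d`-dimensional pseudomanifold: a top chain
`γ` with all coefficients `±1` whose boundary is supported on `∂Δ`. -/
noncomputable def IsOrientation (d : ℕ) (γ : Δ.Chain (d + 1)) : Prop :=
  (∀ f, γ f = 1 ∨ γ f = -1) ∧
  (∀ g : {f // f ∈ Δ.Faces d},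
    (g : Finset (Fin n)) ∉ Δ.pmBoundary d → Δ.bdry d γ g = 0)

/-- `γ_j` as a top-dimensional chain, for a vertex `j` of the `γ`-incidence graph:
the extra vertex `γ_0 = 0` is encoded by `none`, and the oriented facet `γ_f` by
`some f`. -/
noncomputable def gammaInd (D : ℕ) (γ : Δ.Chain (D + 1)) :
    Option {f // f ∈ Δ.Faces (D + 1)} → Δ.Chain (D + 1)
  | none => 0
  | some f => Pi.single f (γ f)

/-- The edge of the `γ`-incidence graph corresponding to the `(D-1)`-dimensional face
`σ` goes from the vertex `a` to the vertex `b`: this means `∂ᵗ(σ) = γ_b - γ_a`. -/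
noncomputable def edgeFromTo (D : ℕ) (γ : Δ.Chain (D + 1)) (σ : {f // f ∈ Δ.Faces D})
    (a b : Option {f // f ∈ Δ.Faces (D + 1)}) : Prop :=
  Δ.tbdry D (Pi.single σ 1) = Δ.gammaInd D γ b - Δ.gammaInd D γ a

/-- `τ` is the incidence vector of a simple directed cycle of the `γ`-incidence graph
`Γ(Δ,γ)`: there is a closed directed walk with pairwise distinct vertices and pairwise
distinct edges whose edge labels sum to `τ`. -/
noncomputable def IsCycleVector (D : ℕ) (γ : Δ.Chain (D + 1)) (τ : Δ.Chain D) : Prop :=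
  ∃ (k : ℕ) (hk : 0 < k) (v : Fin k → Option {f // f ∈ Δ.Faces (D + 1)})
    (e : Fin k → {f // f ∈ Δ.Faces D}),
    Function.Injective v ∧ Function.Injective e ∧
    (∀ t : Fin k, Δ.edgeFromTo D γ (e t) (v t) (v ⟨(t.1 + 1) % k, Nat.mod_lt _ hk⟩)) ∧
    τ = ∑ t : Fin k, Pi.single (e t) (1 : ℤ)

/-! ### Spanning forests -/

/-- The chains supported on a set `F` of faces. -/
def suppIn (k : ℕ) (F : Finset (Finset (Fin n))) : Submodule ℤ (Δ.Chain k) where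
  carrier := {σ | ∀ f : {f // f ∈ Δ.Faces k}, (f : Finset (Fin n)) ∉ F → σ f = 0}
  add_mem' := by
    intro a b ha hb f hf
    simp [Pi.add_apply, ha f hf, hb f hf]
  zero_mem' := by intro f hf; rfl
  smul_mem' := by
    intro c a ha f hf
    simp [Pi.smul_apply, ha f hf]

/-- The reduced homology group `H̃_{i-1}(Υ)` of the subcomplex `Υ` with
`Skel_{i-1}(Υ) = Skel_{i-1}(Δ)` and with set of `i`-faces `F`: namely
`ker ∂_{i-1} / ∂_i(chains supported on F)`. -/
noncomputable abbrev forestHom (i : ℕ) (F : Finset (Finset (Fin n))) : Type :=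
  ↥(Δ.cycles i) ⧸ Submodule.comap (Δ.cycles i).subtype
      (Submodule.map (Δ.bdry i) (Δ.suppIn (i + 1) F))

/-- `F ⊆ Δ_i` encodes a spanning `i`-forest of `Δ`: the `i`-dimensional subcomplex
`Υ` with `Skel_{i-1}(Υ) = Skel_{i-1}(Δ)` and with `i`-faces `F`, subject to:
`H̃_i(Υ) = 0`; `β̃_{i-1}(Υ) = β̃_{i-1}(Δ)`; and `|Υ_i| = |Δ_i| - β̃_i(Skel_i(Δ))`
(note `H̃_i(Skel_i(Δ)) = ker ∂_i` since `Skel_i(Δ)` has no `(i+1)`-faces). -/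
noncomputable def IsSpanningForest (i : ℕ) (F : Finset (Finset (Fin n))) : Prop :=
  F ⊆ Δ.Faces (i + 1) ∧
  (∀ σ ∈ Δ.suppIn (i + 1) F, Δ.bdry i σ = 0 → σ = 0) ∧
  Module.finrank ℤ (Δ.forestHom i F) = Module.finrank ℤ (Δ.RedHomologyAt i) ∧
  F.card = (Δ.Faces (i + 1)).card - Module.finrank ℤ ↥(Δ.cycles (i + 1))

open scoped Classical in
/-- The `i`-forest number `τ_i(Δ) = Σ_Υ |T(H̃_{i-1}(Υ))|²`, the sum over all spanning
`i`-forests of `Δ`. -/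
noncomputable def forestNumber (i : ℕ) : ℕ :=
  ∑ F ∈ (Δ.Faces (i + 1)).powerset.filter (fun F => Δ.IsSpanningForest i F),
    (Nat.card ↥(Submodule.torsion ℤ (Δ.forestHom i F))) ^ 2

/-- Restriction of chains to the coordinates indexed by a subset `Θ` of the faces
(i.e. setting the remaining coordinates to `0`). -/
noncomputable def restrictTo (k : ℕ) (Θ : Finset (Finset (Fin n)))
    (hΘ : Θ ⊆ Δ.Faces k) : Δ.Chain k →ₗ[ℤ] ({f // f ∈ Θ} → ℤ) where
  toFun σ := fun a => σ ⟨a.1, hΘ a.2⟩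
  map_add' := by intros; rfl
  map_smul' := by intros; rfl

/-- The reduced Laplacian: the square submatrix of `L_i` consisting of the rows
and columns indexed by `Θ`, as a linear map `ℤΘ → ℤΘ`. -/
noncomputable def redLap (i : ℕ) (Θ : Finset (Finset (Fin n)))
    (hΘ : Θ ⊆ Δ.Faces (i + 1)) : ({f // f ∈ Θ} → ℤ) →ₗ[ℤ] ({f // f ∈ Θ} → ℤ) :=
  (Matrix.of fun a b : {f // f ∈ Θ} =>
    Δ.LapM i ⟨a.1, hΘ a.2⟩ ⟨b.1, hΘ b.2⟩).mulVecLin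

end SComplex

/-- The alternating sum of `F` over `s`, the `j`-th smallest element having sign `(-1)^j`. -/
def altSum {α : Type*} [LinearOrder α] (s : Finset α) (F : α → ℤ) : ℤ :=
  ∑ v ∈ s, (-1) ^ (s.filter (· < v)).card * F v

section AltSum

variable {α : Type*} [LinearOrder α]

theorem altSum_congr {s : Finset α} {F G : α → ℤ} (h : ∀ v ∈ s, F v = G v) :
    altSum s F = altSum s G :=
  Finset.sum_congr rfl fun v hv => by rw [h v hv]

theorem altSum_add (s : Finset α) (F G : α → ℤ) :
    altSum s (fun v => F v + G v) = altSum s F + altSum s G := by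
  simp [altSum, mul_add, Finset.sum_add_distrib]

theorem altSum_const (s : Finset α) (c : ℤ) :
    altSum s (fun _ => c) = altSum s (fun _ => 1) * c := by
  simp [altSum, Finset.sum_mul]

theorem altSum_neg (s : Finset α) (F : α → ℤ) :
    altSum s (fun v => -F v) = -altSum s F := by
  simp [altSum]

theorem altSum_insert_of_forall_lt {s : Finset α} {m : α} (h : ∀ x ∈ s, x < m) (F : α → ℤ) :
    altSum (insert m s) F = altSum s F + (-1) ^ s.card * F m := by
  have hm : m ∉ s := fun hm => lt_irrefl m (h m hm)
  have hs : (insert m s).filter (· < m) = s := by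
    ext x
    simp only [Finset.mem_filter, Finset.mem_insert]
    exact ⟨fun hx => hx.1.resolve_left hx.2.ne, fun hx => ⟨Or.inr hx, h x hx⟩⟩
  rw [altSum, Finset.sum_insert hm, hs, add_comm]
  congr 1
  refine Finset.sum_congr rfl fun v hv => ?_
  rw [Finset.filter_insert, if_neg (h v hv).not_gt]

theorem altSum_one (s : Finset α) :
    altSum s (fun _ => 1) = if Even s.card then 0 else 1 := by
  induction s using Finset.induction_on_max with
  | empty => simp [altSum]
  | insert m s h ih =>
    have hm : m ∉ s := fun hm => lt_irrefl m (h m hm)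
    rw [altSum_insert_of_forall_lt h, ih, Finset.card_insert_of_notMem hm]
    rcases Nat.even_or_odd s.card with he | ho
    · simp [he, Nat.even_add_one]
    · simp [Nat.not_even_iff_odd.mpr ho, ho.neg_one_pow, Nat.even_add_one]

/-- The alternating sum over `s` of the alternating sums over the sets `s \ {v}`. -/
theorem altSum_altSum_erase (s : Finset α) (w : α → ℤ) :
    altSum s (fun v => altSum (s.erase v) w) = if Even s.card then -altSum s w else 0 := by
  induction s using Finset.induction_on_max with
  | empty => simp [altSum]
  | insert m s h ih =>
    have hm : m ∉ s := fun hm => lt_irrefl m (h m hm)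
    have key : altSum s (fun v => altSum ((insert m s).erase v) w) =
        altSum s (fun v => altSum (s.erase v) w) +
          altSum s (fun _ => 1) * (-(-1) ^ s.card * w m) := by
      rw [← altSum_const, ← altSum_add]
      refine altSum_congr fun v hv => ?_
      have hlt : ∀ x ∈ s.erase v, x < m := fun x hx => h x (Finset.mem_of_mem_erase hx)
      rw [Finset.erase_insert_of_ne (h v hv).ne', altSum_insert_of_forall_lt hlt,
        ← Finset.card_erase_add_one hv, pow_succ]
      ring
    rw [altSum_insert_of_forall_lt h, key, ih, altSum_one, Finset.erase_insert hm,
      altSum_insert_of_forall_lt h, Finset.card_insert_of_notMem hm]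
    rcases Nat.even_or_odd s.card with he | ho
    · simp [he, Nat.even_add_one]
    · simp [Nat.not_even_iff_odd.mpr ho, ho.neg_one_pow, Nat.even_add_one]

theorem altSum_strictMono_bounds {w : α → ℤ} (hw : StrictMono w) (s : Finset α) :
    (Even s.card → altSum s w ≤ 0 ∧ (s.Nonempty → altSum s w < 0)) ∧
      (Odd s.card → ∀ m, (∀ x ∈ s, x < m) → altSum s w < w m) := by
  induction s using Finset.induction_on_max with
  | empty => simp [altSum]
  | insert m s h ih =>
    have hm : m ∉ s := fun hm => lt_irrefl m (h m hm)
    rw [altSum_insert_of_forall_lt h, Finset.card_insert_of_notMem hm]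
    constructor
    · intro he
      have ho : Odd s.card := by rwa [← Nat.not_even_iff_odd, ← Nat.even_add_one]
      have := ih.2 ho m h
      rw [ho.neg_one_pow]
      exact ⟨by linarith, fun _ => by linarith⟩
    · intro ho m' hm'
      have he : Even s.card := by
        rwa [← Nat.not_odd_iff_even, ← Nat.odd_add_one]
      have := (ih.1 he).1
      have := hw (hm' m (Finset.mem_insert_self m s))
      rw [he.neg_one_pow]
      linarith

theorem altSum_neg_of_even_card {w : α → ℤ} (hw : StrictMono w) {s : Finset α}
    (hs : s.Nonempty) (he : Even s.card) : altSum s w < 0 :=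
  ((altSum_strictMono_bounds hw s).1 he).2 hs

end AltSum

namespace SComplex

variable {n : ℕ} (Δ : SComplex n)

theorem bcoef_erase {f : Finset (Fin n)} {v : Fin n} (hv : v ∈ f) :
    bcoef f (f.erase v) = (-1) ^ (f.filter (· < v)).card := by
  have hsdiff : f \ f.erase v = {v} := by
    ext x
    by_cases hx : x = v <;> simp_all
  rw [bcoef, if_pos ⟨Finset.erase_subset v f, (Finset.card_erase_add_one hv).symm⟩, hsdiff,
    Finset.sum_singleton]

theorem transpose_B_mulVec_apply (k : ℕ) (T : Finset (Fin n) → ℤ)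
    (f : {f // f ∈ Δ.Faces (k + 1)}) :
    ((Δ.B k)ᵀ *ᵥ fun g => T g) f = altSum f.1 (fun v => T (f.1.erase v)) := by
  obtain ⟨f, hf⟩ := f
  obtain ⟨hfΔ, hfc⟩ := Finset.mem_filter.mp hf
  simp only [Matrix.mulVec, dotProduct, Matrix.transpose_apply, B]
  rw [Finset.sum_coe_sort (Δ.Faces k) fun g => bcoef f g * T g, altSum]
  symm
  refine Finset.sum_of_injOn f.erase (Finset.erase_injOn f) ?_ ?_ ?_
  · intro v hv
    refine Finset.mem_filter.mpr ⟨Δ.down_closed f hfΔ _ (Finset.erase_subset v f), ?_⟩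
    rw [Finset.card_erase_of_mem hv, hfc, Nat.add_sub_cancel]
  · intro g _ hg
    rw [bcoef, if_neg, zero_mul]
    rintro ⟨hgf, hc⟩
    obtain ⟨v, hv, rfl⟩ : ∃ v ∈ f, f.erase v = g := by
      obtain ⟨v, hv⟩ := Finset.card_eq_one.mp
        (show (f \ g).card = 1 by rw [Finset.card_sdiff_of_subset hgf]; omega)
      refine ⟨v, (Finset.mem_sdiff.mp (hv ▸ Finset.mem_singleton_self v)).1, ?_⟩
      rw [Finset.erase_eq, ← hv, Finset.sdiff_sdiff_eq_self hgf]
    exact hg ⟨v, hv, rfl⟩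
  · intro v hv
    rw [bcoef_erase hv]

theorem Lap_eq_zero_of_altSum_erase_eq_zero (i : ℕ) (T : Finset (Fin n) → ℤ)
    (hT : ∀ f : Finset (Fin n), f.card = i + 2 → altSum f (fun v => T (f.erase v)) = 0) :
    Δ.Lap i (fun g => T g) = 0 := by
  have h : (Δ.B (i + 1))ᵀ *ᵥ (fun g : {f // f ∈ Δ.Faces (i + 1)} => T g) = 0 := by
    ext f
    rw [transpose_B_mulVec_apply, hT f.1 (Finset.mem_filter.mp f.2).2, Pi.zero_apply]
  rw [Lap, Matrix.mulVecLin_apply, LapM, ← Matrix.mulVec_mulVec, h, Matrix.mulVec_zero]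

/-- The kernel of the Laplacian contains a chain with all coefficients positive. -/
theorem exists_pos_mem_ker_Lap (i : ℕ) :
    ∃ τ : Δ.Chain (i + 1), Δ.Lap i τ = 0 ∧ ∀ f, 0 < τ f := by
  rcases Nat.even_or_odd i with he | ho
  · refine ⟨_, Δ.Lap_eq_zero_of_altSum_erase_eq_zero i (fun _ => 1) fun f hf => ?_,
      fun _ => one_pos⟩
    rw [altSum_one, if_pos (by rw [hf]; exact he.add even_two)]
  · have hw : StrictMono fun v : Fin n => (v : ℤ) := fun a b h => by simpa using h
    refine ⟨_, Δ.Lap_eq_zero_of_altSum_erase_eq_zero i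
      (fun g => -altSum g fun v : Fin n => (v : ℤ)) fun f hf => ?_, fun f => ?_⟩
    · rw [altSum_neg, altSum_altSum_erase, if_neg, neg_zero]
      rw [hf, Nat.not_even_iff_odd]
      exact ho.add_even even_two
    · have hc := (Finset.mem_filter.mp f.2).2
      exact neg_pos.mpr <| altSum_neg_of_even_card hw (Finset.card_pos.mp (by omega))
        (by rw [hc]; exact ho.add_one)

end SComplex

/-- If `σ` is an effective `i`-chain of degree zero (that is,
`σ·h = 0` for every `h ∈ ker⁺L_i`), then `σ = 0`. -/
theorem effective_degree_zero_eq_zero {n : ℕ} (Δ : SComplex n) (i : ℕ)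
    (σ : Δ.Chain (i + 1)) (heff : Δ.Effective σ)
    (hdeg : ∀ h ∈ Δ.kerPlus i, Δ.dot σ h = 0) :
    σ = 0 := by
  obtain ⟨τ, hker, hpos⟩ := Δ.exists_pos_mem_ker_Lap i
  have hdot := hdeg τ ⟨hker, fun f => (hpos f).le⟩
  have hterm := (Finset.sum_eq_zero_iff_of_nonneg fun f _ =>
    mul_nonneg (heff f) (hpos f).le).mp hdot
  funext f
  exact (mul_eq_zero.mp (hterm f (Finset.mem_univ f))).resolve_right (hpos f).ne'
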